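/- arXiv:1205.2718 — 2 statements merged into one kernel-verified Lean document; each statement's English description precedes it below -/
import Mathlib

section
/- For every integer q ≥ 3 there exists a constant C > 0 (depending only on q) such that for all integers d ≥ 2 and n ≥ d+1 and every simple n-vertex d-regular graph G whose independence number satisfies α(G) ≤ (n/2)(1 − C√((log d)/d)), the number of proper q-colorings of G satisfies c_q(G) ≤ c_q(K_{d,d})^{n/(2d)}. -/
/-- The number of proper `q`-colorings of a graph `G`. -/
noncomputable def numColorings {V : Type*} (G : SimpleGraph V) (q : ℕ) : ℕ :=
  Nat.card {f : V → Fin q // ∀ v w, G.Adj v w → f v ≠ f w}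

/-- The independence number of `G`: the largest size of a set of pairwise non-adjacent vertices. -/
noncomputable def indepNum {V : Type*} [Fintype V] (G : SimpleGraph V) : ℕ :=
  sSup {k | ∃ s : Finset V, (∀ v ∈ s, ∀ w ∈ s, ¬ G.Adj v w) ∧ s.card = k}

open Finset

section Containers

variable {V : Type*} [Fintype V] [DecidableEq V] (G : SimpleGraph V) [DecidableRel G.Adj]

/-- The set of vertices with a neighbor in `T`. -/
def nbhd (T : Finset V) : Finset V := T.biUnion fun v => G.neighborFinset v

open Classical in
/-- The vertices outside the neighborhood of `T` all but fewer than `φ` of whose neighbors lie in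
the neighborhood of `T`. -/
noncomputable def container (φ : ℝ) (T : Finset V) : Finset V :=
  {v | v ∉ nbhd G T ∧ (#(G.neighborFinset v \ nbhd G T) : ℝ) < φ}

open Classical in
/-- The vertex sets of size at most `|V| / φ`. -/
noncomputable def fingerprints (V : Type*) [Fintype V] (φ : ℝ) : Finset (Finset V) :=
  {T | φ * (#T : ℝ) ≤ Fintype.card V}

variable {G}

lemma exists_fingerprint {φ : ℝ} (hφ : 0 < φ) (I : Finset V)
    (hI : ∀ v ∈ I, ∀ w ∈ I, ¬ G.Adj v w) :
    ∃ T ∈ fingerprints V φ, I ⊆ container G φ T := by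
  classical
  obtain ⟨T, hT, hmax⟩ := Finset.exists_max_image
    (I.powerset.filter fun T => φ * (#T : ℝ) ≤ #(nbhd G T)) card
    ⟨∅, by simp⟩
  simp only [mem_filter, mem_powerset] at hT hmax
  refine ⟨T, ?_, fun v hv => ?_⟩
  · simp only [fingerprints, mem_filter, mem_univ, true_and]
    exact hT.2.trans (by exact_mod_cast card_le_univ _)
  · simp only [container, mem_filter, mem_univ, true_and]
    constructor
    · simp only [nbhd, mem_biUnion, SimpleGraph.mem_neighborFinset, not_exists, not_and]
      exact fun w hw => hI w (hT.1 hw) v hv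
    · by_contra! hlarge
      have hvT : v ∉ T := by
        intro hvT
        have : G.neighborFinset v \ nbhd G T = ∅ := by
          rw [sdiff_eq_empty_iff_subset]
          exact subset_biUnion_of_mem (fun v => G.neighborFinset v) hvT
        rw [this] at hlarge
        simp only [card_empty, Nat.cast_zero] at hlarge
        linarith
      have hle := hmax (insert v T) ⟨insert_subset hv hT.1, by
        have hN : nbhd G (insert v T) = (G.neighborFinset v \ nbhd G T) ∪ nbhd G T := by
          simp [nbhd, biUnion_insert]
        rw [hN, card_union_of_disjoint sdiff_disjoint, card_insert_of_notMem hvT]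
        push_cast
        linarith [hT.2]⟩
      rw [card_insert_of_notMem hvT] at hle
      omega

lemma card_container_mul_le {d : ℕ} (hG : G.IsRegularOfDegree d) (φ : ℝ) (T : Finset V) :
    (#(container G φ T) : ℝ) * (2 * d - φ) ≤ d * Fintype.card V := by
  classical
  have hdeg : ∀ v ∈ container G φ T,
      (d : ℝ) - φ ≤ (#(G.neighborFinset v ∩ nbhd G T) : ℝ) := by
    intro v hv
    simp only [container, mem_filter, mem_univ, true_and] at hv
    have h := card_inter_add_card_sdiff (G.neighborFinset v) (nbhd G T)
    rw [G.card_neighborFinset_eq_degree, hG v] at h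
    have h' : (#(G.neighborFinset v ∩ nbhd G T) : ℝ) + #(G.neighborFinset v \ nbhd G T) = d := by
      exact_mod_cast h
    linarith [hv.2]
  have hlow : (#(container G φ T) : ℝ) * (d - φ) ≤
      ∑ v ∈ container G φ T, (#(G.neighborFinset v ∩ nbhd G T) : ℝ) := by
    rw [← nsmul_eq_mul]
    exact card_nsmul_le_sum _ _ _ hdeg
  have hswap : ∑ v ∈ container G φ T, #(G.neighborFinset v ∩ nbhd G T) =
      ∑ w ∈ nbhd G T, #(G.neighborFinset w ∩ container G φ T) := by
    have h := sum_card_bipartiteAbove_eq_sum_card_bipartiteBelow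
      (s := container G φ T) (t := nbhd G T) (r := G.Adj)
    convert h using 3 with v _ w _
    · ext w; simp [bipartiteAbove, and_comm]
    · ext v; simp [bipartiteBelow, and_comm, G.adj_comm]
  have hup : ∑ w ∈ nbhd G T, #(G.neighborFinset w ∩ container G φ T) ≤ #(nbhd G T) * d := by
    rw [← smul_eq_mul]
    refine sum_le_card_nsmul _ _ _ fun w _ => ?_
    rw [← hG w, ← G.card_neighborFinset_eq_degree]
    exact card_le_card inter_subset_left
  have hdisj : Disjoint (nbhd G T) (container G φ T) := by
    rw [disjoint_right]
    intro v hv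
    simp only [container, mem_filter, mem_univ, true_and] at hv
    exact hv.1
  have hcard : (#(nbhd G T) : ℝ) + #(container G φ T) ≤ Fintype.card V := by
    rw [← Nat.cast_add, ← card_union_of_disjoint hdisj]
    exact_mod_cast card_le_univ _
  have hup' : ∑ v ∈ container G φ T, (#(G.neighborFinset v ∩ nbhd G T) : ℝ) ≤
      #(nbhd G T) * d := by
    rw [← hswap] at hup
    exact_mod_cast hup
  nlinarith [mul_le_mul_of_nonneg_left hcard (Nat.cast_nonneg (α := ℝ) d)]

end Containers

lemma card_fingerprints_le {V : Type*} [Fintype V] {φ x : ℝ} (hφ : 0 < φ) (hx : 0 < x)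
    (hx1 : x ≤ 1) :
    (#(fingerprints V φ) : ℝ) ≤
      Real.exp (Fintype.card V * x - Real.log x * (Fintype.card V / φ)) := by
  have hterm : ∀ T ∈ fingerprints V φ, Real.exp (Real.log x * (Fintype.card V / φ)) ≤ x ^ #T := by
    intro T hT
    simp only [fingerprints, mem_filter, mem_univ, true_and] at hT
    rw [← Real.exp_log (pow_pos hx _), Real.log_pow, Real.exp_le_exp, mul_comm]
    refine mul_le_mul_of_nonpos_right ?_ (Real.log_nonpos hx.le hx1)
    rw [le_div_iff₀ hφ]
    linarith
  have h1 : (#(fingerprints V φ) : ℝ) * Real.exp (Real.log x * (Fintype.card V / φ)) ≤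
      (1 + x) ^ Fintype.card V := by
    rw [← nsmul_eq_mul]
    calc _ ≤ ∑ T ∈ fingerprints V φ, x ^ #T := card_nsmul_le_sum _ _ _ hterm
      _ ≤ ∑ T : Finset V, x ^ #T :=
        sum_le_sum_of_subset_of_nonneg (subset_univ _) fun _ _ _ => by positivity
      _ = _ := by
        have := Fintype.sum_pow_mul_eq_add_pow V x 1
        simpa [add_comm] using this
  have h2 : (1 + x) ^ Fintype.card V ≤ Real.exp (Fintype.card V * x) := by
    rw [Real.exp_nat_mul]
    gcongr
    linarith [Real.add_one_le_exp x]
  rw [Real.exp_sub, le_div_iff₀ (Real.exp_pos _)]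
  exact h1.trans h2

lemma card_offDiag_pairs_le {q : ℕ} (A B : Finset (Fin q)) (i : Fin q) (hA : i ∈ A) (hB : i ∈ B) :
    (#{p ∈ A ×ˢ B | p.1 ≠ p.2} : ℝ) ≤ (1 - 1 / (q : ℝ) ^ 2) * (#A * #B) := by
  have hq : (0 : ℝ) < q := by exact_mod_cast i.pos
  have h1 : #{p ∈ A ×ˢ B | p.1 ≠ p.2} + 1 ≤ #A * #B := by
    rw [← card_product, Nat.succ_le_iff]
    exact card_lt_card (filter_ssubset.2 ⟨(i, i), by simp [hA, hB]⟩)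
  have h1' : (#{p ∈ A ×ˢ B | p.1 ≠ p.2} : ℝ) + 1 ≤ #A * #B := by exact_mod_cast h1
  have hAq : (#A : ℝ) ≤ q := by exact_mod_cast (card_le_univ A).trans_eq (Fintype.card_fin q)
  have hBq : (#B : ℝ) ≤ q := by exact_mod_cast (card_le_univ B).trans_eq (Fintype.card_fin q)
  have h2 : (#A * #B : ℝ) / (q : ℝ) ^ 2 ≤ 1 := by
    rw [div_le_one (by positivity), sq]
    gcongr
  have h3 : (1 - 1 / (q : ℝ) ^ 2) * (#A * #B) = #A * #B - (#A * #B : ℝ) / (q : ℝ) ^ 2 := by ring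
  linarith

/-- The discrete tangent line bound for the logarithm at `m`, with slope `log ((m + 1) / m)`. -/
lemma natCast_le_mul_exp {m : ℕ} (hm : 0 < m) (p : ℕ) :
    (p : ℝ) ≤ m * Real.exp (Real.log ((m + 1) / m) * (p - m)) := by
  have hm' : (0 : ℝ) < m := by exact_mod_cast hm
  have hr : (0 : ℝ) < (m + 1) / m := by positivity
  rcases le_total m p with h | h
  · obtain ⟨k, rfl⟩ := Nat.exists_eq_add_of_le h
    have hb := one_add_mul_le_pow (a := 1 / (m : ℝ))
      (by linarith [show 0 < 1 / (m : ℝ) by positivity]) k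
    have he : Real.exp (Real.log ((m + 1) / m) * ((m + k : ℕ) - m)) = (1 + 1 / (m : ℝ)) ^ k := by
      push_cast
      rw [add_sub_cancel_left, mul_comm, Real.exp_nat_mul, Real.exp_log hr]
      congr 1
      field_simp
    rw [he]
    calc ((m + k : ℕ) : ℝ) = m * (1 + k * (1 / m)) := by push_cast; field_simp
      _ ≤ _ := by gcongr
  · obtain ⟨k, rfl⟩ := Nat.exists_eq_add_of_le h
    have hb := one_add_mul_le_pow (a := -(1 / ((p + k : ℕ) + 1 : ℝ))) (by
      have : 1 / ((p + k : ℕ) + 1 : ℝ) ≤ 1 := by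
        rw [div_le_one (by positivity)]; linarith
      linarith) k
    have he : Real.exp (Real.log (((p + k : ℕ) + 1) / (p + k : ℕ)) * (p - (p + k : ℕ))) =
        (1 + -(1 / ((p + k : ℕ) + 1 : ℝ))) ^ k := by
      have h1 : ((p : ℝ) - (p + k : ℕ)) = -(k : ℝ) := by push_cast; ring
      rw [h1, mul_neg, ← neg_mul, mul_comm, Real.exp_nat_mul, ← Real.log_inv,
        Real.exp_log (inv_pos.2 hr)]
      congr 1
      field_simp
      ring
    rw [he]
    set M : ℝ := ((p + k : ℕ) : ℝ) with hM
    have hp : (p : ℝ) = M - k := by rw [hM]; push_cast; ring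
    calc (p : ℝ) ≤ M * (1 + k * -(1 / (M + 1))) := by
          rw [hp]
          have : M * (1 / (M + 1)) ≤ 1 := by
            rw [mul_one_div, div_le_one (by positivity)]; linarith
          nlinarith [Nat.cast_nonneg (α := ℝ) k]
      _ ≤ _ := by gcongr

lemma card_le_indepNum {V : Type*} [Fintype V] {G : SimpleGraph V} (J : Finset V)
    (hJ : ∀ v ∈ J, ∀ w ∈ J, ¬ G.Adj v w) : #J ≤ indepNum G := by
  refine le_csSup ⟨Fintype.card V, ?_⟩ ⟨J, hJ, rfl⟩
  rintro k ⟨s, -, rfl⟩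
  exact card_le_univ s

section Counting

variable {V : Type*} [Fintype V] [DecidableEq V] {G : SimpleGraph V} [DecidableRel G.Adj]

/-- If every independent subset of `D` misses at least `2k` vertices of `D`, and the color `i` lies in
the list of every vertex of `D`, then a proportion of at most `(1 - 1 / q ^ 2) ^ k` of all choices
from the lists is proper on `D`. -/
lemma card_listColorings_le {q : ℕ} (i : Fin q) (k : ℕ) :
    ∀ (D : Finset V) (S : V → Finset (Fin q)),
      (∀ J ⊆ D, (∀ v ∈ J, ∀ w ∈ J, ¬ G.Adj v w) → #J + 2 * k ≤ #D) →
      (∀ v ∈ D, i ∈ S v) →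
      (#{f ∈ Fintype.piFinset S | ∀ v ∈ D, ∀ w ∈ D, G.Adj v w → f v ≠ f w} : ℝ) ≤
        (1 - 1 / (q : ℝ) ^ 2) ^ k * ∏ v, (#(S v) : ℝ) := by
  induction k with
  | zero =>
    intro D S _ _
    rw [pow_zero, one_mul, ← Nat.cast_prod, ← Fintype.card_piFinset]
    exact_mod_cast card_filter_le _ _
  | succ k ih =>
    intro D S hD hS
    have hq : (1 : ℝ) ≤ q := by exact_mod_cast i.pos
    have hθ : 0 ≤ 1 - 1 / (q : ℝ) ^ 2 := by
      rw [sub_nonneg, div_le_one (by positivity)]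
      nlinarith
    obtain ⟨u, hu, v, hv, huv⟩ : ∃ u ∈ D, ∃ v ∈ D, G.Adj u v := by
      by_contra! h
      have := hD D Subset.rfl h
      omega
    have hne : u ≠ v := huv.ne
    set D' := (D.erase u).erase v with hD'
    have hcard : #D' + 2 = #D := by
      have h1 := card_erase_add_one hu
      have h2 : #D' + 1 = #(D.erase u) := card_erase_add_one (mem_erase.2 ⟨hne.symm, hv⟩)
      omega
    have hsub : D' ⊆ D := (erase_subset _ _).trans (erase_subset _ _)
    let S' : Fin q × Fin q → V → Finset (Fin q) := fun p =>
      Function.update (Function.update S u {p.1}) v {p.2}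
    have hS' : ∀ p, ∀ w ∈ D', i ∈ S' p w := by
      intro p w hw
      simp only [hD', mem_erase] at hw
      simp only [S', Function.update_of_ne hw.1, Function.update_of_ne hw.2.1]
      exact hS w hw.2.2
    set P : ℝ := ∏ w ∈ (univ.erase u).erase v, (#(S w) : ℝ) with hP
    have hprodS : ∏ w, (#(S w) : ℝ) = #(S u) * #(S v) * P := by
      rw [← mul_prod_erase univ _ (mem_univ u),
        ← mul_prod_erase _ _ (mem_erase.2 ⟨hne.symm, mem_univ v⟩), mul_assoc]
    have hprodS' : ∀ p, ∏ w, (#(S' p w) : ℝ) = P := by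
      intro p
      rw [← mul_prod_erase univ _ (mem_univ u),
        ← mul_prod_erase _ _ (mem_erase.2 ⟨hne.symm, mem_univ v⟩)]
      simp only [S', Function.update_self, Function.update_of_ne hne, card_singleton,
        Nat.cast_one, one_mul, hP]
      refine prod_congr rfl fun w hw => ?_
      simp only [mem_erase] at hw
      rw [Function.update_of_ne hw.1, Function.update_of_ne hw.2.1]
    have hcover : {f ∈ Fintype.piFinset S | ∀ v ∈ D, ∀ w ∈ D, G.Adj v w → f v ≠ f w} ⊆
        {p ∈ S u ×ˢ S v | p.1 ≠ p.2}.biUnion fun p =>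
          {f ∈ Fintype.piFinset (S' p) | ∀ v ∈ D', ∀ w ∈ D', G.Adj v w → f v ≠ f w} := by
      intro f hf
      simp only [mem_filter, Fintype.mem_piFinset] at hf
      simp only [mem_biUnion, mem_filter, mem_product, Fintype.mem_piFinset]
      refine ⟨(f u, f v), ⟨⟨hf.1 u, hf.1 v⟩, hf.2 u hu v hv huv⟩, fun w => ?_,
        fun a ha b hb => hf.2 a (hsub ha) b (hsub hb)⟩
      by_cases hwv : w = v
      · subst hwv; simp [S']
      · by_cases hwu : w = u
        · subst hwu; simp [S', Function.update_of_ne hne]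
        · simpa [S', Function.update_of_ne hwv, Function.update_of_ne hwu] using hf.1 w
    calc (#{f ∈ Fintype.piFinset S | ∀ v ∈ D, ∀ w ∈ D, G.Adj v w → f v ≠ f w} : ℝ)
        ≤ ∑ p ∈ S u ×ˢ S v with p.1 ≠ p.2,
          (#{f ∈ Fintype.piFinset (S' p) |
            ∀ v ∈ D', ∀ w ∈ D', G.Adj v w → f v ≠ f w} : ℝ) := by
          exact_mod_cast (card_le_card hcover).trans card_biUnion_le
      _ ≤ ∑ p ∈ S u ×ˢ S v with p.1 ≠ p.2, (1 - 1 / (q : ℝ) ^ 2) ^ k * P := by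
          refine sum_le_sum fun p _ => ?_
          rw [← hprodS' p]
          refine ih D' (S' p) (fun J hJ hind => ?_) (hS' p)
          have := hD J (hJ.trans hsub) hind
          omega
      _ = #{p ∈ S u ×ˢ S v | p.1 ≠ p.2} * ((1 - 1 / (q : ℝ) ^ 2) ^ k * P) := by
          rw [sum_const, nsmul_eq_mul]
      _ ≤ ((1 - 1 / (q : ℝ) ^ 2) * (#(S u) * #(S v))) * ((1 - 1 / (q : ℝ) ^ 2) ^ k * P) := by
          exact mul_le_mul_of_nonneg_right
            (card_offDiag_pairs_le _ _ i (hS u hu) (hS v hv))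
            (mul_nonneg (pow_nonneg hθ k) (prod_nonneg fun _ _ => Nat.cast_nonneg _))
      _ = _ := by rw [hprodS]; ring

variable (G) in
/-- The colors available at each vertex when the `i`-th color class is confined to the container of
`τ i`. -/
noncomputable def colorLists {q : ℕ} (φ : ℝ) (τ : Fin q → Finset V) (v : V) : Finset (Fin q) :=
  {i | v ∈ container G φ (τ i)}

lemma numColorings_le_mul {q : ℕ} {φ : ℝ} (hφ : 0 < φ) (B : ℝ)
    (hB : ∀ τ : Fin q → Finset V, (#{f ∈ Fintype.piFinset (colorLists G φ τ) |
      ∀ v w, G.Adj v w → f v ≠ f w} : ℝ) ≤ B) :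
    (numColorings G q : ℝ) ≤ (#(fingerprints V φ) : ℝ) ^ q * B := by
  have hcover : ({f | ∀ v w, G.Adj v w → f v ≠ f w} : Finset (V → Fin q)) ⊆
      (Fintype.piFinset fun _ : Fin q => fingerprints V φ).biUnion fun τ =>
        {f ∈ Fintype.piFinset (colorLists G φ τ) | ∀ v w, G.Adj v w → f v ≠ f w} := by
    intro f hf
    simp only [mem_filter, mem_univ, true_and] at hf
    have hT : ∀ i : Fin q, ∃ T ∈ fingerprints V φ, ({v | f v = i} : Finset V) ⊆
        container G φ T := by
      refine fun i => exists_fingerprint hφ _ fun v hv w hw hadj => hf v w hadj ?_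
      simp only [mem_filter, mem_univ, true_and] at hv hw
      rw [hv, hw]
    choose τ hτ hsub using hT
    simp only [mem_biUnion, mem_filter, Fintype.mem_piFinset, colorLists, mem_univ, true_and]
    exact ⟨τ, hτ, fun v => hsub (f v) (by simp), hf⟩
  have hnum : numColorings G q = #({f | ∀ v w, G.Adj v w → f v ≠ f w} : Finset (V → Fin q)) := by
    rw [numColorings, Nat.card_eq_fintype_card, Fintype.card_subtype]
  rw [hnum]
  calc _ ≤ ∑ τ ∈ Fintype.piFinset fun _ : Fin q => fingerprints V φ,
        (#{f ∈ Fintype.piFinset (colorLists G φ τ) |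
          ∀ v w, G.Adj v w → f v ≠ f w} : ℝ) := by
        exact_mod_cast (card_le_card hcover).trans card_biUnion_le
    _ ≤ #(Fintype.piFinset fun _ : Fin q => fingerprints V φ) • B :=
        sum_le_card_nsmul _ _ _ fun τ _ => hB τ
    _ = _ := by
        rw [Fintype.card_piFinset, prod_const, card_univ, Fintype.card_fin, nsmul_eq_mul]
        push_cast
        rfl

lemma prod_card_colorLists_le {q m : ℕ} (hm : 0 < m) (φ : ℝ) (τ : Fin q → Finset V) :
    ∏ v, (#(colorLists G φ τ v) : ℝ) ≤ Real.exp (Fintype.card V * Real.log m +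
      Real.log ((m + 1) / m) * (∑ i, (#(container G φ (τ i)) : ℝ) - Fintype.card V * m)) := by
  have hm' : (0 : ℝ) < m := by exact_mod_cast hm
  have hsum : ∑ v, (#(colorLists G φ τ v) : ℝ) = ∑ i, (#(container G φ (τ i)) : ℝ) := by
    have h := sum_card_bipartiteAbove_eq_sum_card_bipartiteBelow
      (s := (univ : Finset V)) (t := (univ : Finset (Fin q)))
      (r := fun v i => v ∈ container G φ (τ i))
    simp only [bipartiteAbove, bipartiteBelow, filter_univ_mem] at h
    exact_mod_cast h
  calc _ ≤ ∏ v, ((m : ℝ) * Real.exp (Real.log ((m + 1) / m) * (#(colorLists G φ τ v) - m))) :=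
        prod_le_prod (fun _ _ => Nat.cast_nonneg _) fun v _ => natCast_le_mul_exp hm _
    _ = _ := by
        rw [prod_mul_distrib, prod_const, card_univ, ← Real.exp_sum, ← mul_sum, sum_sub_distrib,
          hsum, sum_const, card_univ, nsmul_eq_mul, Real.exp_add, Real.exp_nat_mul,
          Real.exp_log hm']

lemma card_listColorings_colorLists_le {q : ℕ} (i : Fin q) (φ : ℝ) (τ : Fin q → Finset V) (k : ℕ)
    (hk : indepNum G + 2 * k ≤ #(container G φ (τ i))) :
    (#{f ∈ Fintype.piFinset (colorLists G φ τ) | ∀ v w, G.Adj v w → f v ≠ f w} : ℝ) ≤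
      (1 - 1 / (q : ℝ) ^ 2) ^ k * ∏ v, (#(colorLists G φ τ v) : ℝ) := by
  refine le_trans ?_ (card_listColorings_le (G := G) i k (container G φ (τ i)) _
    (fun J _ hJ => ?_) fun v hv => ?_)
  · refine Nat.cast_le.2 (card_le_card fun f hf => ?_)
    rw [mem_filter] at hf ⊢
    exact ⟨hf.1, fun v _ w _ => hf.2 v w⟩
  · have := card_le_indepNum J hJ
    omega
  · simpa [colorLists] using hv

end Counting

lemma pow_le_numColorings_completeBipartiteGraph {q m : ℕ} (hm : m ≤ q) (d : ℕ) :
    (m * (q - m)) ^ d ≤ numColorings (completeBipartiteGraph (Fin d) (Fin d)) q := by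
  have hcard : Nat.card ((Fin d → Fin m) × (Fin d → Fin (q - m))) = (m * (q - m)) ^ d := by
    simp [mul_pow]
  rw [← hcard, numColorings]
  let e : Fin m ⊕ Fin (q - m) ≃ Fin q := finSumFinEquiv.trans (finCongr (Nat.add_sub_of_le hm))
  refine Nat.card_le_card_of_injective (fun g =>
    ⟨Sum.elim (fun x => e (Sum.inl (g.1 x))) (fun y => e (Sum.inr (g.2 y))), ?_⟩) ?_
  · rintro (x | x) (y | y) h <;> simp at h ⊢
  · rintro ⟨g₁, g₂⟩ ⟨g₁', g₂'⟩ h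
    simp only [Subtype.mk.injEq] at h
    ext x
    · simpa using congrArg Fin.val (Sum.inl_injective (e.injective (congrFun h (Sum.inl x))))
    · simpa using congrArg Fin.val (Sum.inr_injective (e.injective (congrFun h (Sum.inr x))))

lemma exp_le_numColorings_rpow {q m d : ℕ} (hm : 0 < m) (hmq : m < q) (hd : 0 < d) {t : ℝ}
    (ht : 0 ≤ t) :
    Real.exp (t / 2 * Real.log (m * (q - m))) ≤
      (numColorings (completeBipartiteGraph (Fin d) (Fin d)) q : ℝ) ^ (t / (2 * d)) := by
  have hm' : (0 : ℝ) < m := by exact_mod_cast hm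
  have hqm : (0 : ℝ) < q - m := sub_pos.2 (by exact_mod_cast hmq)
  have hd' : (0 : ℝ) < d := by exact_mod_cast hd
  have h : (((m : ℝ) * (q - m)) ^ d) ≤
      (numColorings (completeBipartiteGraph (Fin d) (Fin d)) q : ℝ) := by
    rw [← Nat.cast_sub hmq.le]
    exact_mod_cast pow_le_numColorings_completeBipartiteGraph hmq.le d
  refine le_trans (le_of_eq ?_) (Real.rpow_le_rpow (by positivity) h (by positivity))
  rw [Real.rpow_def_of_pos (by positivity), Real.log_pow]
  congr 1
  field_simp

lemma log_half_add_eq {q : ℕ} (hq : 2 ≤ q) :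
    Real.log (q / 2 : ℕ) + Real.log (((q / 2 : ℕ) + 1) / (q / 2 : ℕ)) *
        ((q : ℝ) / 2 - (q / 2 : ℕ)) =
      1 / 2 * Real.log ((q / 2 : ℕ) * (q - (q / 2 : ℕ))) := by
  obtain ⟨m, hm⟩ : ∃ m, m = q / 2 := ⟨_, rfl⟩
  rw [← hm]
  have hm0 : (0 : ℝ) < m := by
    have : 0 < m := by omega
    exact_mod_cast this
  rcases (by omega : q = 2 * m ∨ q = 2 * m + 1) with h | h
  · have h' : (q : ℝ) = 2 * m := by exact_mod_cast h
    rw [h', show (2 * m - m : ℝ) = m by ring, Real.log_mul hm0.ne' hm0.ne']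
    ring
  · have h' : (q : ℝ) = 2 * m + 1 := by exact_mod_cast h
    rw [h', show (2 * m + 1 - m : ℝ) = m + 1 by ring, Real.log_mul hm0.ne' (by positivity),
      Real.log_div (by positivity) hm0.ne']
    ring

lemma card_fingerprints_sqrt_le {V : Type*} [Fintype V] {d : ℕ} (hd : 2 ≤ d) :
    (#(fingerprints V (d * Real.sqrt (Real.log d / d))) : ℝ) ≤
      Real.exp (5 / 2 * (Fintype.card V * Real.sqrt (Real.log d / d))) := by
  have hd' : (2 : ℝ) ≤ d := by exact_mod_cast hd
  have hd0 : (0 : ℝ) < d := by linarith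
  have hlog : 1 / 2 ≤ Real.log d := by
    have := Real.log_le_log (by norm_num) hd'
    linarith [Real.log_two_gt_d9]
  set s := Real.sqrt (Real.log d / d) with hs
  have hs0 : 0 < s := Real.sqrt_pos.2 (by positivity)
  have hss : s * s = Real.log d / d := Real.mul_self_sqrt (by positivity)
  have hsd : 1 ≤ Real.sqrt d := Real.one_le_sqrt.2 (by linarith)
  refine (card_fingerprints_le (x := 1 / Real.sqrt d) (by positivity) (by positivity)
    ((div_le_one (by positivity)).2 hsd)).trans (Real.exp_le_exp.2 ?_)
  have h1 : 1 / Real.sqrt d ≤ 2 * s := by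
    rw [← abs_of_pos (show 0 < 1 / Real.sqrt d by positivity),
      ← abs_of_pos (show 0 < 2 * s by positivity), ← sq_le_sq, div_pow, mul_pow,
      Real.sq_sqrt hd0.le, pow_two s, hss, ← mul_div_assoc]
    gcongr
    linarith
  have h2 : Real.log (1 / Real.sqrt d) = - (Real.log d / 2) := by
    rw [one_div, Real.log_inv, Real.log_sqrt hd0.le]
  have h3 : Real.log d = d * (s * s) := by rw [hss]; field_simp
  have h4 : Real.log (1 / Real.sqrt d) * (Fintype.card V / (d * s)) =
      - (Fintype.card V * s / 2) := by
    rw [h2, h3]; field_simp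
  rw [h4]
  have := mul_le_mul_of_nonneg_left h1 (Nat.cast_nonneg (α := ℝ) (Fintype.card V))
  linarith

lemma card_container_sqrt_le {V : Type*} [Fintype V] [DecidableEq V] {G : SimpleGraph V}
    [DecidableRel G.Adj] {d : ℕ} (hd : 0 < d) (hG : G.IsRegularOfDegree d) {s : ℝ} (hs0 : 0 ≤ s)
    (hs1 : s ≤ 1) (T : Finset V) :
    (#(container G (d * s) T) : ℝ) ≤ Fintype.card V / 2 * (1 + s) := by
  have hd' : (0 : ℝ) < d := by exact_mod_cast hd
  have h := card_container_mul_le hG (d * s) T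
  have h' : (#(container G (d * s) T) : ℝ) * (2 - s) ≤ Fintype.card V := by
    refine le_of_mul_le_mul_left ?_ hd'
    linarith
  rw [← le_div_iff₀ (by linarith)] at h'
  refine h'.trans ?_
  rw [div_le_iff₀ (by linarith)]
  nlinarith [mul_nonneg (Nat.cast_nonneg (α := ℝ) (Fintype.card V))
    (mul_nonneg hs0 (sub_nonneg.2 hs1))]


theorem conjecture_holds_small_indep (q : ℕ) (hq : 3 ≤ q) :
    ∃ C : ℝ, 0 < C ∧
      ∀ (d n : ℕ), 2 ≤ d → d + 1 ≤ n →
        ∀ (G : SimpleGraph (Fin n)) [DecidableRel G.Adj],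
          G.IsRegularOfDegree d →
          (indepNum G : ℝ) ≤ ((n : ℝ) / 2) * (1 - C * Real.sqrt (Real.logb 2 d / d)) →
          (numColorings G q : ℝ) ≤
            (numColorings (completeBipartiteGraph (Fin d) (Fin d)) q : ℝ) ^
              ((n : ℝ) / (2 * d)) := by
  obtain ⟨m, hm⟩ : ∃ m, m = q / 2 := ⟨_, rfl⟩
  have hm0 : 0 < m := by omega
  have hmq : m < q := by omega
  have hm0' : (0 : ℝ) < m := by exact_mod_cast hm0
  have hq' : (3 : ℝ) ≤ q := by exact_mod_cast hq
  set L := Real.log (((m : ℝ) + 1) / m) with hL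
  have hL0 : 0 < L := Real.log_pos (by rw [lt_div_iff₀ hm0']; linarith)
  have hθ0 : 0 < 1 - 1 / (q : ℝ) ^ 2 := by
    rw [sub_pos, div_lt_one (by positivity)]
    nlinarith
  have hθ1 : 1 - 1 / (q : ℝ) ^ 2 < 1 := by
    have : 0 < 1 / (q : ℝ) ^ 2 := by positivity
    linarith
  set μ := -Real.log (1 - 1 / (q : ℝ) ^ 2) with hμ
  have hμ0 : 0 < μ := neg_pos.2 (Real.log_neg hθ0 hθ1)
  refine ⟨4 * (q + 5 / 2 * q / L + 1 + (L * q + 5 * q) / μ), by positivity, ?_⟩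
  set A := q + 5 / 2 * q / L + 1 + (L * q + 5 * q) / μ with hA
  have hA1 : (q : ℝ) + 5 / 2 * q / L ≤ A := by
    have : 0 ≤ (L * q + 5 * q) / μ := by positivity
    linarith
  have hA2 : L * q + 5 * q ≤ (A - 1) * μ := by
    rw [← div_le_iff₀ hμ0]
    have : 0 ≤ 5 / 2 * q / L := by positivity
    linarith
  have hA3 : L * q + 5 / 2 * q ≤ L * A := by
    have := mul_le_mul_of_nonneg_left hA1 hL0.le
    rwa [mul_add, mul_div_cancel₀ _ hL0.ne'] at this
  have hA4 : 1 ≤ A := by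
    have h1 : 0 ≤ (L * q + 5 * q) / μ := by positivity
    have h2 : 0 ≤ 5 / 2 * q / L := by positivity
    linarith
  intro d n hd hn G _ hG hα
  have hd' : (2 : ℝ) ≤ d := by exact_mod_cast hd
  have hn' : (d : ℝ) + 1 ≤ n := by exact_mod_cast hn
  have hlog : 0.69 ≤ Real.log d := by
    have := Real.log_le_log (by norm_num) hd'
    linarith [Real.log_two_gt_d9]
  set s := Real.sqrt (Real.log d / d) with hs
  have hs0 : 0 < s := Real.sqrt_pos.2 (by positivity)
  have hsb : s ≤ Real.sqrt (Real.logb 2 d / d) := by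
    refine Real.sqrt_le_sqrt ?_
    gcongr
    rw [Real.logb, le_div_iff₀ (Real.log_pos (by norm_num))]
    nlinarith [Real.log_two_lt_d9]
  have hα' : (indepNum G : ℝ) ≤ n / 2 * (1 - 4 * A * s) := by
    refine hα.trans ?_
    gcongr
  have hs1 : s ≤ 1 := by
    have h0 : 0 ≤ (n : ℝ) / 2 * (1 - 4 * A * s) := (Nat.cast_nonneg _).trans hα'
    have h1 : 0 ≤ 1 - 4 * A * s := nonneg_of_mul_nonneg_right h0 (by linarith)
    nlinarith
  have hns : 1 ≤ n * s := by
    have h1 : 1 ≤ d * s := by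
      have hss : s * s = Real.log d / d := Real.mul_self_sqrt (by positivity)
      have : (d * s) ^ 2 = d * Real.log d := by
        rw [mul_pow, pow_two s, hss]; field_simp
      refine (one_le_sq_iff₀ (by positivity)).1 ?_
      nlinarith
    nlinarith
  have hT := card_fingerprints_sqrt_le (V := Fin n) hd
  rw [← hs, Fintype.card_fin] at hT
  have hmain := numColorings_le_mul (G := G) (q := q) (φ := d * s) (by positivity)
    (Real.exp (n / 2 * Real.log (m * (q - m)) - q * (5 / 2 * (n * s)))) ?_
  · refine hmain.trans (le_trans ?_
      (exp_le_numColorings_rpow (d := d) hm0 hmq (by omega) (Nat.cast_nonneg n)))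
    calc _ ≤ Real.exp (5 / 2 * (n * s)) ^ q *
          Real.exp (n / 2 * Real.log (m * (q - m)) - q * (5 / 2 * (n * s))) := by gcongr
      _ = _ := by
          rw [← Real.exp_nat_mul, ← Real.exp_add]
          congr 1
          ring
  intro τ
  have hD : ∀ i, (#(container G (d * s) (τ i)) : ℝ) ≤ n / 2 * (1 + s) := fun i => by
    simpa using card_container_sqrt_le (by omega) hG hs0.le hs1 (τ i)
  have hprod := prod_card_colorLists_le (G := G) hm0 (d * s) τ
  have hident := log_half_add_eq (q := q) (by omega)
  rw [← hm, ← hL] at hident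
  rw [← hL, Fintype.card_fin] at hprod
  let i₀ : Fin q := ⟨0, by omega⟩
  rcases le_or_gt (#(container G (d * s) (τ i₀)) : ℝ) (n / 2 * (1 - 2 * A * s)) with hc | hc
  · have hsum : ∑ i, (#(container G (d * s) (τ i)) : ℝ) ≤
        n / 2 * (1 - 2 * A * s) + q * (n / 2 * (1 + s)) - n / 2 := by
      rw [← add_sum_erase univ _ (mem_univ i₀)]
      have h := sum_le_card_nsmul (univ.erase i₀) _ _ fun i _ => hD i
      rw [card_erase_of_mem (mem_univ i₀), card_univ, Fintype.card_fin, nsmul_eq_mul,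
        Nat.cast_sub (by omega), Nat.cast_one] at h
      have : 0 ≤ n / 2 * s := by positivity
      linarith
    refine le_trans ?_ (hprod.trans (Real.exp_le_exp.2 ?_))
    · rw [← Nat.cast_prod, ← Fintype.card_piFinset]
      exact_mod_cast card_filter_le _ _
    · have h1 := mul_le_mul_of_nonneg_left hsum hL0.le
      have h2 := mul_le_mul_of_nonneg_right hA3 (show 0 ≤ n * s by positivity)
      have h3 : 0 ≤ L * q * (n * s) := by positivity
      have h4 := congrArg (fun z => (n : ℝ) * z) hident
      linarith
  · set D := #(container G (d * s) (τ i₀)) with hDdef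
    obtain ⟨k, hk⟩ : ∃ k, k = (D - indepNum G) / 2 := ⟨_, rfl⟩
    have hAs : 0 ≤ n * (A * s) := by positivity
    have hle : indepNum G ≤ D := by
      have : (indepNum G : ℝ) ≤ D := by linarith
      exact_mod_cast this
    have hk2 : (D : ℝ) ≤ indepNum G + 2 * k + 1 := by
      have : D ≤ indepNum G + 2 * k + 1 := by omega
      exact_mod_cast this
    refine (card_listColorings_colorLists_le i₀ (d * s) τ k (by omega)).trans ?_
    have hθk : (1 - 1 / (q : ℝ) ^ 2) ^ k = Real.exp (-(k * μ)) := by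
      rw [hμ, mul_neg, neg_neg, Real.exp_nat_mul, Real.exp_log hθ0]
    rw [hθk]
    refine (mul_le_mul_of_nonneg_left hprod (Real.exp_pos _).le).trans ?_
    rw [← Real.exp_add, Real.exp_le_exp]
    have hsum : ∑ i, (#(container G (d * s) (τ i)) : ℝ) ≤ q * (n / 2 * (1 + s)) := by
      have h := sum_le_card_nsmul univ _ _ fun i _ => hD i
      rwa [card_univ, Fintype.card_fin, nsmul_eq_mul] at h
    have hk3 : (A - 1) * (n * s) ≤ 2 * k := by linarith
    have h1 := mul_le_mul_of_nonneg_left hsum hL0.le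
    have h2 := mul_le_mul_of_nonneg_right hA2 (show 0 ≤ n * s by positivity)
    have h3 := mul_le_mul_of_nonneg_right hk3 hμ0.le
    have h4 := congrArg (fun z => (n : ℝ) * z) hident
    linarith
end

section
/- For every integer q ≥ 3 there exists a constant C > 1 (depending only on q) such that for all integers d ≥ 2 and n ≥ d+1 and every simple n-vertex d-regular graph G, the number of proper q-colorings of G satisfies c_q(G) ≤ η(q)^{n/2} · m(q)^{n(q−1)/(qd)} · C^{n/d²}. -/
/-- `η(q) = ⌊q/2⌋ ⌈q/2⌉`, which is `q²/4` for even `q` and `(q²-1)/4` for odd `q`. -/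
def eta (q : ℕ) : ℕ := (q / 2) * ((q + 1) / 2)

/-- `m(q)`: `C(q, q/2)` for even `q` and `C(q+1, (q+1)/2)` for odd `q`. -/
def mq (q : ℕ) : ℕ :=
  if Even q then Nat.choose q (q / 2) else Nat.choose (q + 1) ((q + 1) / 2)

open Finset

/-- Jensen's inequality for the logarithm, in the form of a bound on a sum of logarithms. -/
theorem sum_log_le_card_mul_log {Ω : Type*} (S : Finset Ω) (g : Ω → ℝ) (K : ℝ) (hK : 0 < K)
    (hg : ∀ x ∈ S, 0 < g x) (h : ∑ x ∈ S, g x ≤ #S * K) :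
    ∑ x ∈ S, Real.log (g x) ≤ #S * Real.log K := by
  have h1 : ∀ x ∈ S, Real.log (g x) ≤ Real.log K + (g x / K - 1) := by
    intro x hx
    have := Real.log_le_sub_one_of_pos (div_pos (hg x hx) hK)
    rw [Real.log_div (hg x hx).ne' hK.ne'] at this
    linarith
  have h2 : (∑ x ∈ S, g x) / K ≤ #S := by rwa [div_le_iff₀ hK]
  calc _ ≤ ∑ x ∈ S, (Real.log K + (g x / K - 1)) := sum_le_sum h1
    _ = #S * Real.log K + ((∑ x ∈ S, g x) / K - #S) := by
        simp [sum_add_distrib, sum_sub_distrib, sum_div]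
    _ ≤ _ := by linarith

/-- The number of elements of `S` on which `f` takes the value `a`. -/
def fiberCard {Ω α : Type*} [DecidableEq α] (S : Finset Ω) (f : Ω → α) (a : α) : ℕ :=
  #{y ∈ S | f y = a}

section Entropy

variable {Ω α β γ : Type*} [DecidableEq α] [DecidableEq β] [DecidableEq γ] (S : Finset Ω)

theorem fiberCard_pos (f : Ω → α) {x : Ω} (hx : x ∈ S) : 0 < fiberCard S f (f x) :=
  card_pos.2 ⟨x, by simp [hx]⟩

theorem sum_comp_div_fiberCard (f : Ω → α) (g : α → ℝ) :
    ∑ x ∈ S, g (f x) / fiberCard S f (f x) = ∑ a ∈ S.image f, g a := by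
  rw [sum_comp (fun a => g a / (fiberCard S f a : ℝ)) f]
  refine sum_congr rfl fun a ha => ?_
  obtain ⟨x, hx, rfl⟩ := mem_image.1 ha
  have : (fiberCard S f (f x) : ℝ) ≠ 0 := by exact_mod_cast (fiberCard_pos S f hx).ne'
  rw [nsmul_eq_mul]
  exact mul_div_cancel₀ _ this

theorem sum_fiberCard (f : Ω → α) : ∑ a ∈ S.image f, (fiberCard S f a : ℝ) = #S := by
  rw [← sum_comp_div_fiberCard]
  rw [sum_congr rfl fun x hx => div_self (by exact_mod_cast (fiberCard_pos S f hx).ne')]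
  simp

theorem sum_fiberCard_prod [Fintype γ] (f : Ω → α) (X : Ω → γ) (a : α) :
    ∑ c, fiberCard S (fun x => (f x, X x)) (a, c) = fiberCard S f a := by
  have := card_eq_sum_card_fiberwise (s := {y ∈ S | f y = a}) (f := X) (t := univ)
    (fun _ _ => by simp)
  rw [fiberCard, this]
  simp [fiberCard, filter_filter, Prod.ext_iff]

/-- If `x` is uniform on `S`, this is `#S` times the conditional entropy of `x` given `f x`. -/
noncomputable def sumLogFiber (f : Ω → α) : ℝ := ∑ x ∈ S, Real.log (fiberCard S f (f x))

theorem sumLogFiber_congr {f : Ω → α} {g : Ω → β} (h : ∀ x y, f y = f x ↔ g y = g x) :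
    sumLogFiber S f = sumLogFiber S g := by
  simp [sumLogFiber, fiberCard, h]

/-- Conditioning on more information does not increase the conditional entropy. -/
theorem sumLogFiber_sub_anti [Fintype γ] (W : Ω → α) (Z : Ω → β) (φ : α → β)
    (hφ : ∀ x, φ (W x) = Z x) (X : Ω → γ) :
    sumLogFiber S W - sumLogFiber S (fun x => (W x, X x)) ≤
      sumLogFiber S Z - sumLogFiber S (fun x => (Z x, X x)) := by
  set nW : Ω → ℝ := fun x => fiberCard S W (W x)
  set nZ : Ω → ℝ := fun x => fiberCard S Z (Z x)
  set nWX : Ω → ℝ := fun x => fiberCard S (fun x => (W x, X x)) (W x, X x)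
  set nZX : Ω → ℝ := fun x => fiberCard S (fun x => (Z x, X x)) (Z x, X x)
  have pW : ∀ x ∈ S, 0 < nW x := fun x hx => Nat.cast_pos.2 (fiberCard_pos S W hx)
  have pZ : ∀ x ∈ S, 0 < nZ x := fun x hx => Nat.cast_pos.2 (fiberCard_pos S Z hx)
  have pWX : ∀ x ∈ S, 0 < nWX x := fun x hx =>
    Nat.cast_pos.2 (fiberCard_pos S (fun x => (W x, X x)) hx)
  have pZX : ∀ x ∈ S, 0 < nZX x := fun x hx =>
    Nat.cast_pos.2 (fiberCard_pos S (fun x => (Z x, X x)) hx)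
  have hsum : ∑ x ∈ S, nW x * nZX x / nZ x / nWX x ≤ #S * 1 := by
    have e := sum_comp_div_fiberCard S (fun x => (W x, X x)) (fun a =>
      (fiberCard S W a.1 : ℝ) * fiberCard S (fun x => (Z x, X x)) (φ a.1, a.2) /
        fiberCard S Z (φ a.1))
    simp only [hφ] at e
    calc _ = _ := e
      _ ≤ ∑ a ∈ S.image W ×ˢ (univ : Finset γ),
          (fiberCard S W a.1 : ℝ) * fiberCard S (fun x => (Z x, X x)) (φ a.1, a.2) /
            fiberCard S Z (φ a.1) := by
        refine sum_le_sum_of_subset_of_nonneg ?_ fun _ _ _ => by positivity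
        intro a ha
        obtain ⟨x, hx, rfl⟩ := mem_image.1 ha
        simpa using ⟨x, hx, rfl⟩
      _ = ∑ a ∈ S.image W, (fiberCard S W a : ℝ) := by
        rw [sum_product]
        refine sum_congr rfl fun a ha => ?_
        obtain ⟨x, hx, rfl⟩ := mem_image.1 ha
        dsimp only
        rw [← sum_div, ← mul_sum, ← Nat.cast_sum, sum_fiberCard_prod, hφ]
        exact mul_div_cancel_right₀ _ (pZ x hx).ne'
      _ = _ := by rw [sum_fiberCard, mul_one]
  have key := sum_log_le_card_mul_log S _ 1 one_pos (fun x hx => div_pos (div_pos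
    (mul_pos (pW x hx) (pZX x hx)) (pZ x hx)) (pWX x hx)) hsum
  have : ∑ x ∈ S, Real.log (nW x * nZX x / nZ x / nWX x) =
      ∑ x ∈ S, (Real.log (nW x) + Real.log (nZX x) - Real.log (nZ x) - Real.log (nWX x)) := by
    refine sum_congr rfl fun x hx => ?_
    rw [Real.log_div (div_pos (mul_pos (pW x hx) (pZX x hx)) (pZ x hx)).ne' (pWX x hx).ne',
      Real.log_div (mul_pos (pW x hx) (pZX x hx)).ne' (pZ x hx).ne',
      Real.log_mul (pW x hx).ne' (pZX x hx).ne']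
  rw [this] at key
  simp only [sum_sub_distrib, sum_add_distrib, Real.log_one, mul_zero] at key
  simp only [sumLogFiber]
  linarith

/-- The conditional entropy of `X` given `Z` is at most the average logarithm of the
conditional support size. -/
theorem sumLogFiber_sub_le_sum_log (Z : Ω → α) (X : Ω → γ) (A : α → Finset γ)
    (hA : ∀ x ∈ S, X x ∈ A (Z x)) :
    sumLogFiber S Z - sumLogFiber S (fun x => (Z x, X x)) ≤
      ∑ x ∈ S, Real.log #(A (Z x)) := by
  set nZ : Ω → ℝ := fun x => fiberCard S Z (Z x)
  set nZX : Ω → ℝ := fun x => fiberCard S (fun x => (Z x, X x)) (Z x, X x)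
  have pZ : ∀ x ∈ S, 0 < nZ x := fun x hx => Nat.cast_pos.2 (fiberCard_pos S Z hx)
  have pZX : ∀ x ∈ S, 0 < nZX x := fun x hx =>
    Nat.cast_pos.2 (fiberCard_pos S (fun x => (Z x, X x)) hx)
  have pA : ∀ x ∈ S, (0 : ℝ) < #(A (Z x)) := fun x hx => by
    exact_mod_cast card_pos.2 ⟨_, hA x hx⟩
  have hsum : ∑ x ∈ S, nZ x / #(A (Z x)) / nZX x ≤ #S * 1 := by
    calc _ = _ := sum_comp_div_fiberCard S (fun x => (Z x, X x))
            (fun a => (fiberCard S Z a.1 : ℝ) / #(A a.1))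
      _ ≤ ∑ a ∈ (S.image Z).sigma A, (fiberCard S Z a.1 : ℝ) / #(A a.1) := by
        refine le_of_le_of_eq ?_ (sum_map ((S.image Z).sigma A)
          (Equiv.sigmaEquivProd α γ).toEmbedding
          (fun a => (fiberCard S Z a.1 : ℝ) / #(A a.1)))
        refine sum_le_sum_of_subset_of_nonneg ?_ fun _ _ _ => by positivity
        intro a ha
        obtain ⟨x, hx, rfl⟩ := mem_image.1 ha
        simpa using ⟨⟨x, hx, rfl⟩, hA x hx⟩
      _ = ∑ a ∈ S.image Z, (fiberCard S Z a : ℝ) := by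
        rw [sum_sigma]
        refine sum_congr rfl fun a ha => ?_
        obtain ⟨x, hx, rfl⟩ := mem_image.1 ha
        simp only [sum_const, nsmul_eq_mul]
        exact mul_div_cancel₀ _ (pA x hx).ne'
      _ = _ := by rw [sum_fiberCard, mul_one]
  have key := sum_log_le_card_mul_log S _ 1 one_pos (fun x hx => div_pos (div_pos
    (pZ x hx) (pA x hx)) (pZX x hx)) hsum
  have : ∑ x ∈ S, Real.log (nZ x / #(A (Z x)) / nZX x) =
      ∑ x ∈ S, (Real.log (nZ x) - Real.log #(A (Z x)) - Real.log (nZX x)) := by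
    refine sum_congr rfl fun x hx => ?_
    rw [Real.log_div (div_pos (pZ x hx) (pA x hx)).ne' (pZX x hx).ne',
      Real.log_div (pZ x hx).ne' (pA x hx).ne']
  rw [this] at key
  simp only [sum_sub_distrib, Real.log_one, mul_zero] at key
  simp only [sumLogFiber]
  linarith

/-- A bound for the entropy of `Z` together with `p` conditionally independent copies of `X`. -/
theorem entropy_add_mul_le (Z : Ω → α) (X : Ω → γ) (A : α → Finset γ)
    (hA : ∀ x ∈ S, X x ∈ A (Z x)) (p : ℕ) (K : ℝ) (hK : 0 < K)
    (h : ∑ a ∈ S.image Z, (#(A a) : ℝ) ^ p ≤ K) :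
    #S * Real.log #S - sumLogFiber S Z +
      p * (sumLogFiber S Z - sumLogFiber S (fun x => (Z x, X x))) ≤ #S * Real.log K := by
  have h1 := sumLogFiber_sub_le_sum_log S Z X A hA
  have pZ : ∀ x ∈ S, (0 : ℝ) < fiberCard S Z (Z x) := fun x hx => by
    exact_mod_cast fiberCard_pos S Z hx
  have pA : ∀ x ∈ S, (0 : ℝ) < #(A (Z x)) ^ p := fun x hx => by
    have := card_pos.2 ⟨_, hA x hx⟩
    positivity
  have pS : ∀ x ∈ S, (0 : ℝ) < #S := fun x hx => by exact_mod_cast card_pos.2 ⟨x, hx⟩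
  have hsum : ∑ x ∈ S, #S * (#(A (Z x)) : ℝ) ^ p / fiberCard S Z (Z x) ≤ #S * K := by
    rw [sum_comp_div_fiberCard S Z (fun a => #S * (#(A a) : ℝ) ^ p), ← mul_sum]
    gcongr
  have key := sum_log_le_card_mul_log S _ K hK (fun x hx => div_pos
    (mul_pos (pS x hx) (pA x hx)) (pZ x hx)) hsum
  have : ∑ x ∈ S, Real.log (#S * (#(A (Z x)) : ℝ) ^ p / fiberCard S Z (Z x)) =
      ∑ x ∈ S, (Real.log #S + p * Real.log #(A (Z x)) -
        Real.log (fiberCard S Z (Z x))) := by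
    refine sum_congr rfl fun x hx => ?_
    rw [Real.log_div (mul_pos (pS x hx) (pA x hx)).ne' (pZ x hx).ne',
      Real.log_mul (pS x hx).ne' (pA x hx).ne', Real.log_pow]
  rw [this] at key
  simp only [sum_sub_distrib, sum_add_distrib, ← mul_sum, sum_const, nsmul_eq_mul] at key
  have := mul_le_mul_of_nonneg_left h1 (Nat.cast_nonneg (α := ℝ) p)
  have e : ∑ x ∈ S, Real.log (fiberCard S Z (Z x)) = sumLogFiber S Z := rfl
  linarith

end Entropy

theorem sum_comp_rank {α : Type*} [DecidableEq α] (W : Finset α) (r : α → ℕ)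
    (hr : Function.Injective r) (f : ℕ → ℝ) :
    ∑ w ∈ W, f #{u ∈ W | r u < r w} = ∑ j ∈ range #W, f j := by
  induction W using Finset.induction_on_max_value r with
  | empty => simp
  | insert a s ha hmax ih =>
    have hlt : ∀ x ∈ s, r x < r a := fun x hx =>
      lt_of_le_of_ne (hmax x hx) fun e => ha (hr e ▸ hx)
    rw [sum_insert ha, card_insert_of_notMem ha, sum_range_succ, ← ih, add_comm]
    congr 1
    · refine sum_congr rfl fun w hw => ?_
      rw [filter_insert, if_neg (hlt w hw).not_gt]
    · rw [filter_insert, if_neg (lt_irrefl _), filter_true_of_mem hlt]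

/-- In a uniformly random order, the rank of `v` in `insert v T` is uniformly distributed. -/
theorem card_add_one_mul_sum_perm {n : ℕ} (T : Finset (Fin n)) (v : Fin n) (hv : v ∉ T)
    (f : ℕ → ℝ) :
    (#T + 1 : ℝ) * ∑ σ : Equiv.Perm (Fin n), f #{u ∈ T | (σ u).val < (σ v).val} =
      n.factorial * ∑ j ∈ range (#T + 1), f j := by
  have hT : ∀ σ : Equiv.Perm (Fin n), #{u ∈ T | (σ u).val < (σ v).val} =
      #{u ∈ insert v T | (σ u).val < (σ v).val} := fun σ => by
    rw [filter_insert, if_neg (lt_irrefl _)]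
  have hswap : ∀ w ∈ insert v T,
      ∑ σ : Equiv.Perm (Fin n), f #{u ∈ insert v T | (σ u).val < (σ w).val} =
        ∑ σ : Equiv.Perm (Fin n), f #{u ∈ insert v T | (σ u).val < (σ v).val} := by
    intro w hw
    refine Fintype.sum_equiv (Equiv.mulRight (Equiv.swap v w)) _ _ fun σ => ?_
    congr 1
    have hmem : ∀ u, Equiv.swap v w u ∈ insert v T ↔ u ∈ insert v T := by
      intro u
      rw [Equiv.swap_apply_def]
      split_ifs with h1 h2
      · subst h1; simp [hw]
      · subst h2; simp [hw]
      · rfl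
    refine card_equiv (Equiv.swap v w) fun u => ?_
    simp only [mem_filter, hmem, Equiv.coe_mulRight, Equiv.Perm.mul_apply, Equiv.swap_apply_self,
      Equiv.swap_apply_left]
  have e : ∑ w ∈ insert v T, ∑ σ : Equiv.Perm (Fin n),
      f #{u ∈ insert v T | (σ u).val < (σ w).val} = _ := sum_congr rfl hswap
  rw [sum_comm, sum_congr rfl fun σ _ => sum_comp_rank (insert v T) (fun u => (σ u).val)
    (Fin.val_injective.comp σ.injective) f] at e
  simp only [hT]
  simpa [card_insert_of_notMem hv, Fintype.card_perm] using e.symm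

/-- The number of proper `q`-colorings of the complete bipartite graph `K_{p,p}`, counted by the
coloring of one side. -/
def bipColorings (q p : ℕ) : ℕ := ∑ y : Fin p → Fin q, #(univ.image y)ᶜ ^ p

theorem sum_card_compl_image_pow {α : Type*} [Fintype α] [DecidableEq α] (q : ℕ) :
    ∑ y : α → Fin q, #(univ.image y)ᶜ ^ Fintype.card α = bipColorings q (Fintype.card α) := by
  refine Fintype.sum_equiv ((Fintype.equivFin α).arrowCongr (Equiv.refl _)) _ _ fun y => ?_
  congr 3
  ext c
  simp only [mem_image, mem_univ, true_and, Equiv.arrowCongr_apply, Function.comp, Equiv.refl_apply]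
  exact (Fintype.equivFin α).exists_congr fun a => by simp

theorem bipColorings_zero (q : ℕ) : bipColorings q 0 = 1 := by
  simp [bipColorings]

theorem bipColorings_le_sum (q p : ℕ) :
    bipColorings q p ≤ ∑ A : Finset (Fin q), (#A * (q - #A)) ^ p := by
  rw [bipColorings, ← sum_fiberwise univ (fun y : Fin p → Fin q => univ.image y)]
  refine sum_le_sum fun A _ => ?_
  have h1 : ∑ y : Fin p → Fin q with univ.image y = A, #(univ.image y)ᶜ ^ p =
      ∑ y : Fin p → Fin q with univ.image y = A, (q - #A) ^ p := by
    refine sum_congr rfl fun y hy => ?_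
    rw [(mem_filter.1 hy).2, card_compl, Fintype.card_fin]
  rw [h1, sum_const, smul_eq_mul, mul_pow]
  gcongr
  calc _ ≤ #(Fintype.piFinset fun _ : Fin p => A) := by
        refine card_le_card fun y hy => ?_
        rw [Fintype.mem_piFinset]
        intro i
        rw [← (mem_filter.1 hy).2]
        exact mem_image_of_mem _ (mem_univ _)
    _ = _ := by simp

theorem one_le_eta {q : ℕ} (hq : 3 ≤ q) : 1 ≤ eta q :=
  Nat.mul_le_mul (by omega : 1 ≤ q / 2) (by omega : 1 ≤ (q + 1) / 2)

theorem mul_sub_le_eta (q k : ℕ) : k * (q - k) ≤ eta q := by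
  rcases le_total q k with h | h
  · simp [Nat.sub_eq_zero_of_le h]
  obtain ⟨j, rfl⟩ := Nat.exists_eq_add_of_le h
  rw [Nat.add_sub_cancel_left, eta]
  obtain ⟨a, ha | ha⟩ := Nat.even_or_odd' (k + j)
  · have h1 : (k + j) / 2 = a := by omega
    have h2 : (k + j + 1) / 2 = a := by omega
    rw [h1, h2]
    zify at ha ⊢
    nlinarith [sq_nonneg ((k : ℤ) - j)]
  · have h1 : (k + j) / 2 = a := by omega
    have h2 : (k + j + 1) / 2 = a + 1 := by omega
    rw [h1, h2]
    have h3 : k ≤ a ∧ a + 1 ≤ j ∨ j ≤ a ∧ a + 1 ≤ k := by omega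
    zify at ha h3 ⊢
    rcases h3 with ⟨h3, h4⟩ | ⟨h3, h4⟩
    · have : (j : ℤ) = 2 * a + 1 - k := by linarith
      rw [this]
      nlinarith [mul_nonneg (sub_nonneg.2 h3) (sub_nonneg.2 h3)]
    · have : (k : ℤ) = 2 * a + 1 - j := by linarith
      rw [this]
      nlinarith [mul_nonneg (sub_nonneg.2 h3) (sub_nonneg.2 h3)]

theorem eq_half_of_mul_sub_eq_eta {q k : ℕ} (hk : k ≤ q) (h : k * (q - k) = eta q) :
    k = q / 2 ∨ k = (q + 1) / 2 := by
  obtain ⟨j, rfl⟩ := Nat.exists_eq_add_of_le hk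
  rw [Nat.add_sub_cancel_left, eta] at h
  obtain ⟨a, ha | ha⟩ := Nat.even_or_odd' (k + j)
  · have h1 : (k + j) / 2 = a := by omega
    have h2 : (k + j + 1) / 2 = a := by omega
    rw [h1, h2] at h ⊢
    have : (k : ℤ) - a = 0 := by
      zify at ha h
      have : (j : ℤ) = 2 * a - k := by linarith
      rw [this] at h
      exact pow_eq_zero_iff (n := 2) (by norm_num) |>.1 (by linarith)
    left; omega
  · have h1 : (k + j) / 2 = a := by omega
    have h2 : (k + j + 1) / 2 = a + 1 := by omega
    rw [h1, h2] at h ⊢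
    have : ((k : ℤ) - a) * (k - (a + 1)) = 0 := by
      zify at ha h
      have : (j : ℤ) = 2 * a + 1 - k := by linarith
      rw [this] at h
      linarith
    rcases mul_eq_zero.1 this with h | h
    · left; omega
    · right; omega

theorem card_filter_eq_eta_le (q : ℕ) :
    #{A : Finset (Fin q) | #A * (q - #A) = eta q} ≤ mq q := by
  have hsub : ({A : Finset (Fin q) | #A * (q - #A) = eta q} : Finset _) ⊆
      powersetCard (q / 2) univ ∪ powersetCard ((q + 1) / 2) univ := by
    intro A hA
    have := eq_half_of_mul_sub_eq_eta (card_finset_fin_le A) (mem_filter.1 hA).2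
    simpa [mem_powersetCard] using this
  refine (card_le_card hsub).trans ?_
  rw [mq]
  split_ifs with h
  · have : (q + 1) / 2 = q / 2 := by obtain ⟨a, rfl⟩ := h; omega
    rw [this, union_self, card_powersetCard, card_univ, Fintype.card_fin]
  · have : (q + 1) / 2 = q / 2 + 1 := by
      obtain ⟨a, rfl⟩ := Nat.not_even_iff_odd.1 h
      omega
    refine (card_union_le _ _).trans ?_
    simp only [card_powersetCard, card_univ, Fintype.card_fin, this]
    exact (Nat.choose_succ_succ q (q / 2)).ge

theorem mq_pos (q : ℕ) : 0 < mq q := by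
  rw [mq]
  split_ifs
  · exact Nat.choose_pos (by omega)
  · exact Nat.choose_pos (by omega)

theorem bipColorings_le {q : ℕ} (hq : 3 ≤ q) (p : ℕ) :
    (bipColorings q p : ℝ) ≤
      mq q * (eta q : ℝ) ^ p * (1 + 2 ^ q * (1 - 1 / (eta q : ℝ)) ^ p) := by
  have he := one_le_eta hq
  have he' : (1 : ℝ) ≤ eta q := by exact_mod_cast he
  have hm : (1 : ℝ) ≤ mq q := by exact_mod_cast mq_pos q
  have hnat : bipColorings q p ≤ mq q * eta q ^ p + 2 ^ q * (eta q - 1) ^ p := by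
    refine (bipColorings_le_sum q p).trans ?_
    rw [← sum_filter_add_sum_filter_not univ
      (fun A : Finset (Fin q) => #A * (q - #A) = eta q)]
    refine add_le_add ?_ ?_
    · rw [sum_congr rfl fun A hA => by rw [(mem_filter.1 hA).2], sum_const, smul_eq_mul]
      exact Nat.mul_le_mul_right _ (card_filter_eq_eta_le q)
    · refine (sum_le_card_nsmul _ _ ((eta q - 1) ^ p) fun A hA => ?_).trans ?_
      · refine Nat.pow_le_pow_left ?_ p
        have h1 := mul_sub_le_eta q #A
        have h2 := (mem_filter.1 hA).2
        omega
      · rw [smul_eq_mul]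
        refine Nat.mul_le_mul_right _ ((card_le_univ _).trans ?_)
        simp
  have hcast : (bipColorings q p : ℝ) ≤ mq q * (eta q : ℝ) ^ p + 2 ^ q * ((eta q : ℝ) - 1) ^ p := by
    have := (Nat.cast_le (α := ℝ)).2 hnat
    push_cast [Nat.cast_sub he] at this
    exact this
  have hmul : ((eta q : ℝ) - 1) ^ p = (eta q : ℝ) ^ p * (1 - 1 / (eta q : ℝ)) ^ p := by
    rw [← mul_pow]
    congr 1
    field_simp
  have hr : 0 ≤ 1 - 1 / (eta q : ℝ) := by
    rw [sub_nonneg]; exact div_le_one_of_le₀ he' (by positivity)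
  refine hcast.trans ?_
  rw [hmul, mul_add, mul_one]
  have : 0 ≤ 2 ^ q * ((eta q : ℝ) ^ p * (1 - 1 / (eta q : ℝ)) ^ p) := by positivity
  nlinarith

section Order

variable {V γ : Type*} [DecidableEq γ] (S : Finset (V → γ)) (r : V → ℕ)

/-- `#S` times the conditional entropy of a uniform element of `S` given its restriction
to `A`. -/
noncomputable def restrictEntropy (A : Finset V) : ℝ := sumLogFiber S (A.restrict (π := fun _ => γ))

theorem restrictEntropy_insert [DecidableEq V] (A : Finset V) (v : V) :
    restrictEntropy S (insert v A) = sumLogFiber S (fun x => (A.restrict x, x v)) := by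
  refine sumLogFiber_congr S fun x y => ?_
  simp only [funext_iff, restrict, Subtype.forall, mem_insert, forall_eq_or_imp, Prod.ext_iff]
  exact and_comm

theorem restrictEntropy_empty : restrictEntropy S ∅ = #S * Real.log #S := by
  have : ∀ x y : V → γ, (∅ : Finset V).restrict (π := fun _ => γ) x =
      (∅ : Finset V).restrict y := fun _ _ => Subsingleton.elim _ _
  rw [restrictEntropy, sumLogFiber, sum_congr rfl fun x _ => by
    rw [fiberCard, filter_true_of_mem fun y _ => this y x]]
  simp

theorem restrictEntropy_univ [Fintype V] : restrictEntropy S univ = 0 := by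
  refine sum_eq_zero fun x hx => ?_
  have : fiberCard S ((univ : Finset V).restrict (π := fun _ => γ))
      ((univ : Finset V).restrict x) = 1 := by
    rw [fiberCard, card_eq_one]
    refine ⟨x, ?_⟩
    ext y
    simp only [mem_filter, mem_singleton, funext_iff, restrict, Subtype.forall, mem_univ,
      true_imp_iff]
    exact ⟨fun h => h.2, fun h => ⟨(funext h : y = x) ▸ hx, h⟩⟩
  rw [this]; simp

theorem restrictEntropy_sub_anti [DecidableEq V] [Fintype γ] {P B : Finset V} (h : P ⊆ B) (v : V) :
    restrictEntropy S B - restrictEntropy S (insert v B) ≤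
      restrictEntropy S P - restrictEntropy S (insert v P) := by
  rw [restrictEntropy_insert, restrictEntropy_insert]
  exact sumLogFiber_sub_anti S (B.restrict (π := fun _ => γ)) (P.restrict (π := fun _ => γ))
    (restrict₂ (π := fun _ => γ) h) (fun _ => rfl) (fun x => x v)

/-- `#S` times the entropy of the value at `v` given the values at all vertices before `v`. -/
noncomputable def stepEntropy [Fintype V] [DecidableEq V] (v : V) : ℝ :=
  restrictEntropy S {u | r u < r v} - restrictEntropy S (insert v ({u | r u < r v} : Finset V))

theorem sum_stepEntropy_le [Fintype V] [DecidableEq V] [Fintype γ]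
    (hr : Function.Injective r) (A : Finset V) :
    ∑ u ∈ A, stepEntropy S r u ≤ restrictEntropy S ∅ - restrictEntropy S A := by
  induction A using Finset.induction_on_max_value r with
  | empty => simp
  | insert a s ha hmax ih =>
    have hs : s ⊆ ({u | r u < r a} : Finset V) := fun x hx => by
      simpa using lt_of_le_of_ne (hmax x hx) fun e => ha (hr e ▸ hx)
    have := restrictEntropy_sub_anti S hs a
    rw [sum_insert ha, stepEntropy]
    linarith

theorem sum_stepEntropy_of_lower [Fintype V] [DecidableEq V] (A : Finset V) (hr : Function.Injective r)
    (hA : ∀ u ∈ A, ∀ w, r w < r u → w ∈ A) :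
    ∑ u ∈ A, stepEntropy S r u = restrictEntropy S ∅ - restrictEntropy S A := by
  induction A using Finset.induction_on_max_value r with
  | empty => simp
  | insert a s ha hmax ih =>
    have hlt : ∀ x ∈ s, r x < r a := fun x hx =>
      lt_of_le_of_ne (hmax x hx) fun e => ha (hr e ▸ hx)
    have hs : ({u | r u < r a} : Finset V) = s := by
      ext x
      simp only [mem_filter, mem_univ, true_and]
      refine ⟨fun h => ?_, hlt x⟩
      rcases mem_insert.1 (hA a (mem_insert_self _ _) x h) with rfl | h'
      · exact absurd h (lt_irrefl _)
      · exact h'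
    have := ih fun u hu w hw => by
      rcases mem_insert.1 (hA u (mem_insert_of_mem hu) w hw) with rfl | h'
      · exact absurd (hw.trans (hlt u hu)) (lt_irrefl _)
      · exact h'
    rw [sum_insert ha, stepEntropy, hs, this]
    ring

end Order

section Graph

variable {V : Type*} [Fintype V] (G : SimpleGraph V) [DecidableRel G.Adj]
  (r : V → ℕ)

/-- The neighbors of `v` preceding `v` in the order given by `r`. -/
def earlier (v : V) : Finset V := {u | G.Adj v u ∧ r u < r v}

/-- The finset of proper `q`-colorings. -/
def properColorings [DecidableEq V] (q : ℕ) : Finset (V → Fin q) := {f | ∀ v w, G.Adj v w → f v ≠ f w}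

theorem card_earlier_add_card_later [DecidableEq V] (hr : Function.Injective r) {d : ℕ}
    (hG : G.IsRegularOfDegree d) (v : V) :
    #(earlier G r v) + #{w | v ∈ earlier G r w} = d := by
  rw [← hG v, ← SimpleGraph.card_neighborFinset_eq_degree, earlier, ← card_union_of_disjoint]
  · congr 1
    ext u
    simp only [earlier, mem_union, mem_filter, mem_univ, true_and,
      SimpleGraph.mem_neighborFinset, G.adj_comm u v, ← and_or_left]
    refine ⟨fun h => h.1, fun h => ⟨h, lt_or_gt_of_ne fun e => h.ne (hr e).symm⟩⟩
  · rw [disjoint_left]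
    intro u hu hu'
    simp only [earlier, mem_filter, mem_univ, true_and] at hu hu'
    omega

theorem sum_card_earlier [DecidableEq V] (hr : Function.Injective r) {d : ℕ} (hG : G.IsRegularOfDegree d) :
    2 * ∑ v, #(earlier G r v) = Fintype.card V * d := by
  have h := sum_congr rfl fun v (_ : v ∈ (univ : Finset V)) => card_earlier_add_card_later G r hr hG v
  rw [sum_add_distrib] at h
  have hc : ∑ v, #{w | v ∈ earlier G r w} = ∑ v, #(earlier G r v) := by
    simp only [card_filter]
    rw [sum_comm]
    refine sum_congr rfl fun v _ => ?_
    simp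
  rw [hc] at h
  simp at h
  omega

/-- The entropy bound for proper colorings of a regular graph with an ordered vertex set. -/
theorem mul_log_card_properColorings_le [DecidableEq V] (hr : Function.Injective r) {d : ℕ}
    (hG : G.IsRegularOfDegree d) (q : ℕ) (hS : (properColorings G q).Nonempty) :
    d * Real.log #(properColorings G q) ≤
      ∑ v, Real.log (bipColorings q #(earlier G r v)) := by
  set S := properColorings G q
  have hN : (0 : ℝ) < #S := by exact_mod_cast card_pos.2 hS
  have htot : ∑ v, stepEntropy S r v = #S * Real.log #S := by
    rw [sum_stepEntropy_of_lower S r univ hr (by simp), restrictEntropy_empty,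
      restrictEntropy_univ, sub_zero]
  have hterm : ∀ v, ∑ u ∈ earlier G r v, stepEntropy S r u +
      #(earlier G r v) * stepEntropy S r v ≤
        #S * Real.log (bipColorings q #(earlier G r v)) := by
    intro v
    set P := earlier G r v
    have h1 := sum_stepEntropy_le S r hr P
    have h2 : stepEntropy S r v ≤ restrictEntropy S P - restrictEntropy S (insert v P) :=
      restrictEntropy_sub_anti S (fun u hu => by
        simp only [P, earlier, mem_filter] at hu
        simpa using hu.2.2) v
    have h2' := mul_le_mul_of_nonneg_left h2 (Nat.cast_nonneg (α := ℝ) #P)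
    rw [restrictEntropy_empty] at h1
    rw [restrictEntropy_insert] at h2'
    have hA : ∀ x ∈ S, x v ∈ (univ.image (P.restrict (π := fun _ => Fin q) x))ᶜ := by
      intro x hx
      simp only [S, properColorings, mem_filter, mem_univ, true_and] at hx
      simp only [mem_compl, mem_image, mem_univ, true_and, Subtype.exists, not_exists]
      intro u hu e
      simp only [P, earlier, mem_filter, mem_univ, true_and] at hu
      exact hx v u hu.1 e.symm
    have hsum : ∑ a ∈ S.image (P.restrict (π := fun _ => Fin q)),
        (#(univ.image a)ᶜ : ℝ) ^ #P ≤ bipColorings q #P := by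
      have := sum_card_compl_image_pow (α := P) q
      rw [Fintype.card_coe] at this
      rw [← this]
      push_cast
      exact sum_le_sum_of_subset_of_nonneg (subset_univ _) fun _ _ _ => by positivity
    have hK : (0 : ℝ) < bipColorings q #P := by
      refine lt_of_lt_of_le ?_ hsum
      obtain ⟨x, hx⟩ := hS
      refine sum_pos' (fun _ _ => by positivity) ⟨_, mem_image_of_mem _ hx, ?_⟩
      have := card_pos.2 ⟨_, hA x hx⟩
      positivity
    have h3 := entropy_add_mul_le S (P.restrict (π := fun _ => Fin q)) (fun x => x v)
      (fun a => (univ.image a)ᶜ) hA #P _ hK hsum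
    unfold restrictEntropy at *
    linarith
  have hsum := sum_le_sum fun v (_ : v ∈ univ) => hterm v
  have hswap : ∑ v, ∑ u ∈ earlier G r v, stepEntropy S r u =
      ∑ u, (#{w | u ∈ earlier G r w} : ℝ) * stepEntropy S r u := by
    rw [sum_comm' (t' := univ) (s' := fun u => {w | u ∈ earlier G r w}) (by simp)]
    simp
  rw [sum_add_distrib, hswap, ← sum_add_distrib, ← mul_sum] at hsum
  have hd : ∀ v, (#{w | v ∈ earlier G r w} : ℝ) * stepEntropy S r v +
      #(earlier G r v) * stepEntropy S r v = d * stepEntropy S r v := by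
    intro v
    rw [← card_earlier_add_card_later G r hr hG v]
    push_cast
    ring
  rw [sum_congr rfl fun v _ => hd v, ← mul_sum, htot] at hsum
  refine le_of_mul_le_mul_left ?_ hN
  linarith

end Graph

theorem numColorings_eq_card_properColorings {V : Type*} [Fintype V] [DecidableEq V]
    (G : SimpleGraph V) [DecidableRel G.Adj] (q : ℕ) :
    numColorings G q = #(properColorings G q) := by
  rw [numColorings, Nat.card_eq_fintype_card, Fintype.card_subtype, properColorings]

theorem log_bipColorings_le {q : ℕ} (hq : 3 ≤ q) (p : ℕ) :
    Real.log (bipColorings q p) ≤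
      p * Real.log (eta q) + (Real.log (mq q) + 2 ^ q * (1 - 1 / (eta q : ℝ)) ^ p) := by
  have he : (1 : ℝ) ≤ eta q := by exact_mod_cast one_le_eta hq
  have hm : (1 : ℝ) ≤ mq q := by exact_mod_cast mq_pos q
  have hr : 0 ≤ 1 - 1 / (eta q : ℝ) := by
    rw [sub_nonneg]; exact div_le_one_of_le₀ he (by positivity)
  have hle := Real.log_nonneg he
  have hlm := Real.log_nonneg hm
  rcases Nat.eq_zero_or_pos (bipColorings q p) with h0 | hpos
  · rw [h0]
    simp only [Nat.cast_zero, Real.log_zero]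
    positivity
  · have h := Real.log_le_log (by exact_mod_cast hpos) (bipColorings_le hq p)
    rw [Real.log_mul (by positivity) (by positivity), Real.log_mul (by positivity) (by positivity),
      Real.log_pow] at h
    have := Real.log_le_sub_one_of_pos
      (by positivity : 0 < 1 + 2 ^ q * (1 - 1 / (eta q : ℝ)) ^ p)
    linarith

theorem sum_range_one_sub_inv_pow_le {e : ℝ} (he : 1 ≤ e) (N : ℕ) :
    ∑ j ∈ range N, (1 - 1 / e) ^ j ≤ e := by
  have hr : 0 ≤ 1 - 1 / e := by
    rw [sub_nonneg]; exact div_le_one_of_le₀ he (by positivity)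
  have h := mul_neg_geom_sum (1 - 1 / e) N
  have h1 : (1 - (1 - 1 / e)) * ∑ j ∈ range N, (1 - 1 / e) ^ j ≤ 1 := by
    rw [h]; linarith [pow_nonneg hr N]
  rw [sub_sub_cancel, div_mul_eq_mul_div, one_mul, div_le_one (by positivity)] at h1
  exact h1

theorem add_one_mul_one_sub_inv_pow_le {e : ℝ} (he : 1 ≤ e) (k : ℕ) :
    (k + 1 : ℝ) * (1 - 1 / e) ^ k ≤ e := by
  have hr : 0 ≤ 1 - 1 / e := by
    rw [sub_nonneg]; exact div_le_one_of_le₀ he (by positivity)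
  have hr1 : 1 - 1 / e ≤ 1 := by
    rw [sub_le_self_iff]; positivity
  refine le_trans ?_ (sum_range_one_sub_inv_pow_le he (k + 1))
  have := card_nsmul_le_sum (range (k + 1)) (fun j => (1 - 1 / e) ^ j) ((1 - 1 / e) ^ k)
    fun j hj => pow_le_pow_of_le_one hr hr1 (by simpa [Nat.lt_succ_iff] using hj)
  simpa using this

section RandomOrder

variable {n : ℕ} (I : Finset (Fin n)) (σ : Equiv.Perm (Fin n))

/-- The order that lists the vertices of `I` first, and orders by `σ` inside and outside `I`. -/
def rankFirst (v : Fin n) : ℕ := if v ∈ I then (σ v).val else n + (σ v).val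

theorem rankFirst_injective : Function.Injective (rankFirst I σ) := by
  intro u v h
  apply σ.injective
  apply Fin.ext
  have := (σ u).isLt
  have := (σ v).isLt
  unfold rankFirst at h
  split_ifs at h <;> omega

variable (G : SimpleGraph (Fin n)) [DecidableRel G.Adj]

theorem earlier_rankFirst_of_mem (hI : ∀ u ∈ I, ∀ v ∈ I, ¬G.Adj u v) {v : Fin n} (hv : v ∈ I) :
    earlier G (rankFirst I σ) v = ∅ := by
  refine filter_eq_empty_iff.2 fun u _ h => ?_
  have hu : u ∉ I := fun hu => hI v hv u hu h.1
  have := h.2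
  rw [rankFirst, rankFirst, if_neg hu, if_pos hv] at this
  have := (σ v).isLt
  omega

theorem card_earlier_rankFirst {v : Fin n} (hv : v ∉ I) :
    #(earlier G (rankFirst I σ) v) = #{u ∈ G.neighborFinset v | u ∈ I} +
      #{u ∈ ({u ∈ G.neighborFinset v | u ∉ I} : Finset (Fin n)) | (σ u).val < (σ v).val} := by
  rw [← card_filter_add_card_filter_not (s := earlier G (rankFirst I σ) v) (fun u => u ∈ I)]
  congr 2
  · ext u
    simp only [earlier, mem_filter, mem_univ, true_and, SimpleGraph.mem_neighborFinset]
    refine ⟨fun h => ⟨h.1.1, h.2⟩, fun h => ⟨⟨h.1, ?_⟩, h.2⟩⟩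
    rw [rankFirst, rankFirst, if_pos h.2, if_neg hv]
    have := (σ u).isLt
    omega
  · ext u
    simp only [earlier, mem_filter, mem_univ, true_and, SimpleGraph.mem_neighborFinset]
    by_cases hu : u ∈ I
    · simp [hu]
    · simp [rankFirst, hu, hv]

theorem mul_sum_perm_pow_card_earlier_le {d : ℕ} (hG : G.IsRegularOfDegree d) {e : ℝ} (he : 1 ≤ e)
    {v : Fin n} (hv : v ∉ I) :
    d * ∑ σ : Equiv.Perm (Fin n), (1 - 1 / e) ^ #(earlier G (rankFirst I σ) v) ≤
      n.factorial * e ^ 2 := by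
  have hr : 0 ≤ 1 - 1 / e := by
    rw [sub_nonneg]; exact div_le_one_of_le₀ he (by positivity)
  set k := #{u ∈ G.neighborFinset v | u ∈ I} with hk
  set T : Finset (Fin n) := {u ∈ G.neighborFinset v | u ∉ I} with hT
  have hd : k + #T = d := by
    rw [← hG v, ← SimpleGraph.card_neighborFinset_eq_degree]
    exact card_filter_add_card_filter_not _
  have h := card_add_one_mul_sum_perm T v (by simp [hT]) (fun j => (1 - 1 / e) ^ (k + j))
  simp only [← card_earlier_rankFirst I _ G hv, hk, hT] at h
  rw [← hk, ← hT] at h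
  have hdle : (d : ℝ) ≤ (k + 1) * (#T + 1) := by
    rw [← hd]; push_cast
    nlinarith [Nat.cast_nonneg (α := ℝ) k, Nat.cast_nonneg (α := ℝ) #T,
      mul_nonneg (Nat.cast_nonneg (α := ℝ) k) (Nat.cast_nonneg (α := ℝ) #T)]
  calc _ ≤ ((k + 1 : ℝ) * (#T + 1)) *
          ∑ σ : Equiv.Perm (Fin n), (1 - 1 / e) ^ #(earlier G (rankFirst I σ) v) := by
        gcongr
    _ = n.factorial * (((k + 1 : ℝ) * (1 - 1 / e) ^ k) *
          ∑ j ∈ range (#T + 1), (1 - 1 / e) ^ j) := by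
        rw [mul_assoc, h]
        simp only [pow_add, ← mul_sum]
        ring
    _ ≤ n.factorial * (e * e) := by
        gcongr
        · exact add_one_mul_one_sub_inv_pow_le he k
        · exact sum_range_one_sub_inv_pow_le he _
    _ = _ := by ring

theorem mul_log_card_le_of_order {q d : ℕ} (hq : 3 ≤ q) (hG : G.IsRegularOfDegree d)
    (hS : (properColorings G q).Nonempty) (hI : ∀ u ∈ I, ∀ v ∈ I, ¬G.Adj u v)
    (hcard : n ≤ q * #I) :
    d * Real.log #(properColorings G q) ≤ n * d / 2 * Real.log (eta q) +
      n * (q - 1) / q * Real.log (mq q) +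
      2 ^ q * ∑ v ∈ Iᶜ, (1 - 1 / (eta q : ℝ)) ^ #(earlier G (rankFirst I σ) v) := by
  have hinj := rankFirst_injective I σ
  set p : Fin n → ℕ := fun v => #(earlier G (rankFirst I σ) v) with hp
  have hmain := mul_log_card_properColorings_le G (rankFirst I σ) hinj hG q hS
  have hm : 0 ≤ Real.log (mq q) := Real.log_nonneg (by exact_mod_cast mq_pos q)
  have hsum : ∑ v, (p v : ℝ) = n * d / 2 := by
    have h := sum_card_earlier G (rankFirst I σ) hinj hG
    have h' : (2 : ℝ) * ∑ v, (p v : ℝ) = n * d := by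
      rw [Fintype.card_fin] at h
      exact_mod_cast h
    linarith
  have hfin : ∑ v, Real.log (bipColorings q (p v)) ≤ ∑ v, (p v : ℝ) * Real.log (eta q) +
      ∑ v ∈ Iᶜ, (Real.log (mq q) + 2 ^ q * (1 - 1 / (eta q : ℝ)) ^ p v) := by
    rw [← sum_add_sum_compl I, ← sum_add_sum_compl I (fun v => (p v : ℝ) * Real.log (eta q)),
      add_assoc, ← sum_add_distrib]
    refine add_le_add (sum_le_sum fun v hv => ?_) (sum_le_sum fun v _ => log_bipColorings_le hq _)
    simp [hp, earlier_rankFirst_of_mem I σ G hI hv, bipColorings_zero]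
  rw [← sum_mul, hsum, sum_add_distrib, ← mul_sum, sum_const, nsmul_eq_mul, card_compl,
    Fintype.card_fin, Nat.cast_sub (card_finset_fin_le I)] at hfin
  have hq0 : (0 : ℝ) < q := by exact_mod_cast (by omega : 0 < q)
  have hcomp : (n : ℝ) - #I ≤ n * (q - 1) / q := by
    rw [le_div_iff₀ hq0]
    have : (n : ℝ) ≤ q * #I := by exact_mod_cast hcard
    linarith
  have := mul_le_mul_of_nonneg_right hcomp hm
  linarith

end RandomOrder

theorem exists_large_independent {n q : ℕ} (hq : 0 < q) (G : SimpleGraph (Fin n))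
    [DecidableRel G.Adj] (hS : (properColorings G q).Nonempty) :
    ∃ I : Finset (Fin n), (∀ u ∈ I, ∀ v ∈ I, ¬G.Adj u v) ∧ n ≤ q * #I := by
  obtain ⟨f, hf⟩ := hS
  simp only [properColorings, mem_filter, mem_univ, true_and] at hf
  by_contra! h
  have hlt : ∀ c : Fin q, q * #{v | f v = c} < n := fun c => h _ fun u hu v hv huv =>
    hf u v huv ((mem_filter.1 hu).2.trans (mem_filter.1 hv).2.symm)
  have hsum : ∑ c : Fin q, #{v | f v = c} = n := by
    rw [← card_eq_sum_card_fiberwise (fun _ _ => by simp)]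
    simp
  have : Nonempty (Fin q) := ⟨⟨0, hq⟩⟩
  have := sum_lt_sum_of_nonempty (univ_nonempty (α := Fin q)) fun c _ => hlt c
  rw [← mul_sum, hsum] at this
  simp at this

theorem log_card_properColorings_le {n q d : ℕ} (hq : 3 ≤ q) (hd : 0 < d)
    (G : SimpleGraph (Fin n)) [DecidableRel G.Adj] (hG : G.IsRegularOfDegree d)
    (hS : (properColorings G q).Nonempty) :
    Real.log #(properColorings G q) ≤ Real.log (eta q) * (n / 2) +
      Real.log (mq q) * (n * (q - 1) / (q * d)) + 2 ^ q * (eta q : ℝ) ^ 2 * (n / d ^ 2) := by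
  obtain ⟨I, hI, hcard⟩ := exists_large_independent (by omega) G hS
  have he : (1 : ℝ) ≤ eta q := by exact_mod_cast one_le_eta hq
  have hd0 : (0 : ℝ) < d := by exact_mod_cast hd
  have hq0 : (0 : ℝ) < q := by exact_mod_cast (by omega : 0 < q)
  have hsum := sum_le_sum fun σ (_ : σ ∈ (univ : Finset (Equiv.Perm (Fin n)))) =>
    mul_log_card_le_of_order I σ G hq hG hS hI hcard
  rw [sum_add_distrib, sum_const, sum_const, ← mul_sum, sum_comm, card_univ, Fintype.card_perm,
    Fintype.card_fin, nsmul_eq_mul, nsmul_eq_mul] at hsum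
  have herr : ∑ v ∈ Iᶜ, ∑ σ : Equiv.Perm (Fin n),
      (1 - 1 / (eta q : ℝ)) ^ #(earlier G (rankFirst I σ) v) ≤
        n * (n.factorial * (eta q : ℝ) ^ 2 / d) := by
    refine (sum_le_card_nsmul _ _ (n.factorial * (eta q : ℝ) ^ 2 / d) fun v hv => ?_).trans ?_
    · rw [le_div_iff₀ hd0, mul_comm]
      exact mul_sum_perm_pow_card_earlier_le I G hG he (mem_compl.1 hv)
    · rw [nsmul_eq_mul]
      gcongr
      exact card_finset_fin_le _
  have herr' := mul_le_mul_of_nonneg_left herr (by positivity : (0 : ℝ) ≤ 2 ^ q)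
  refine le_of_mul_le_mul_left (?_ : (n.factorial * d : ℝ) * _ ≤ (n.factorial * d : ℝ) * _)
    (by positivity)
  calc _ = (n.factorial : ℝ) * (d * Real.log #(properColorings G q)) := by ring
    _ ≤ _ := hsum
    _ ≤ _ := add_le_add_right herr' _
    _ = _ := by field_simp

theorem colorings_previous_best_bound (q : ℕ) (hq : 3 ≤ q) :
    ∃ C : ℝ, 1 < C ∧
      ∀ (d n : ℕ), 2 ≤ d → d + 1 ≤ n →
        ∀ (G : SimpleGraph (Fin n)) [DecidableRel G.Adj],
          G.IsRegularOfDegree d →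
          (numColorings G q : ℝ) ≤
            (eta q : ℝ) ^ ((n : ℝ) / 2) *
              (mq q : ℝ) ^ ((n : ℝ) * ((q : ℝ) - 1) / ((q : ℝ) * d)) *
              C ^ ((n : ℝ) / (d : ℝ) ^ 2) := by
  have he : (0 : ℝ) < eta q := by exact_mod_cast one_le_eta hq
  have hm : (0 : ℝ) < mq q := by exact_mod_cast mq_pos q
  refine ⟨Real.exp (2 ^ q * (eta q : ℝ) ^ 2), Real.one_lt_exp_iff.2 (by positivity), ?_⟩
  intro d n hd _ G _ hG
  rw [numColorings_eq_card_properColorings]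
  rcases (properColorings G q).eq_empty_or_nonempty with h0 | hS
  · rw [h0, card_empty, Nat.cast_zero]
    positivity
  · have h := log_card_properColorings_le hq (by omega) G hG hS
    rw [Real.log_le_iff_le_exp (by exact_mod_cast card_pos.2 hS), Real.exp_add,
      Real.exp_add] at h
    rwa [Real.rpow_def_of_pos he, Real.rpow_def_of_pos hm, ← Real.exp_mul]
end
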